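/- arXiv:2212.04561 — 2 statements merged into one kernel-verified Lean document; each statement's English description precedes it below -/
import Mathlib

section
/- Let p and q be coprime odd positive integers with p < q, and let p' be an odd integer with 0 < p' < q and p·p' ≡ 1 (mod q). Then Σ_{i=0}^{q-1} (−1)^{⌊i·p/q⌋} = Σ_{i=0}^{q-1} (−1)^{⌊i·p'/q⌋}. -/
/-- For odd `p` and `q`, the quotient of `i * p` by `q` has the parity of `i + i * p % q`. -/
theorem neg_one_pow_mul_div_eq {p q : ℕ} (hp : Odd p) (hq : Odd q) (i : ℕ) :
    (-1 : ℤ) ^ (i * p / q) = (-1) ^ (i + i * p % q) := by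
  have h : Even (q * (i * p / q) + i * p % q) ↔ Even (i * p) := by rw [Nat.div_add_mod]
  have hp' : ¬ Even p := Nat.not_even_iff_odd.mpr hp
  have hq' : ¬ Even q := Nat.not_even_iff_odd.mpr hq
  apply neg_one_pow_congr
  simp only [Nat.even_add, Nat.even_mul, hp', hq', false_or, or_false] at h ⊢
  tauto

/-- Multiplication by `b` modulo `q` undoes multiplication by `a` when `a * b ≡ 1`. -/
theorem mul_mod_mul_mod_of_inverse {a b q i : ℕ} (h : a * b % q = 1) (hi : i < q) :
    i * a % q * b % q = i := by
  rw [Nat.mod_mul_mod, mul_assoc, ← Nat.mul_mod_mod, h, mul_one, Nat.mod_eq_of_lt hi]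

/-- `Σ_{i=0}^{q-1} (−1)^{⌊ip/q⌋} = Σ_{i=0}^{q-1} (−1)^{⌊ip'/q⌋}` when
`p, p', q` are odd, `0 < p, p' < q`, `p` is coprime to `q` and `p·p' ≡ 1 (mod q)`. -/
theorem sum_signs_eq_of_inverse (p q p' : ℕ) (hpq : Nat.Coprime p q)
    (hpodd : Odd p) (hqodd : Odd q) (hp0 : 0 < p) (hplt : p < q)
    (hp'odd : Odd p') (hp'0 : 0 < p') (hp'lt : p' < q) (hinv : p * p' % q = 1) :
    ∑ i ∈ Finset.range q, (-1 : ℤ) ^ (i * p / q) =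
      ∑ i ∈ Finset.range q, (-1 : ℤ) ^ (i * p' / q) := by
  have hq : 0 < q := hp0.trans hplt
  have hinv' : p' * p % q = 1 := by rwa [mul_comm]
  refine Finset.sum_nbij' (fun i => i * p % q) (fun j => j * p' % q)
    (fun i _ => Finset.mem_range.mpr (Nat.mod_lt _ hq))
    (fun j _ => Finset.mem_range.mpr (Nat.mod_lt _ hq))
    (fun i hi => mul_mod_mul_mod_of_inverse hinv (Finset.mem_range.mp hi))
    (fun j hj => mul_mod_mul_mod_of_inverse hinv' (Finset.mem_range.mp hj))
    (fun i hi => ?_)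
  rw [neg_one_pow_mul_div_eq hpodd hqodd, neg_one_pow_mul_div_eq hp'odd hqodd,
    mul_mod_mul_mod_of_inverse hinv (Finset.mem_range.mp hi), add_comm]
end

section
/- For every n ≥ 0, the Fibonacci polynomial F_n is log-concave in the sense that for every integer j ≥ 2 one has F_n.coeff(j−2)·F_n.coeff(j+2) ≤ (F_n.coeff(j))² (equivalently, the sequence of coefficients of the powers of x of a fixed parity appearing in F_n is log-concave). -/
/-- The Fibonacci polynomials: `F_0 = 0`, `F_1 = 1`, `F_{n+2} = x·F_{n+1} + F_n`. -/
noncomputable def fibPoly : ℕ → Polynomial ℤ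
  | 0 => 0
  | 1 => 1
  | n + 2 => Polynomial.X * fibPoly (n + 1) + fibPoly n

theorem fibPoly_succ_coeff (n j : ℕ) :
    (fibPoly (n + 1)).coeff j = if Even (n + j) then (((n + j) / 2).choose j : ℤ) else 0 := by
  induction n using Nat.strong_induction_on generalizing j with
  | _ n ih =>
    match n with
    | 0 =>
      rw [fibPoly, Polynomial.coeff_one]
      rcases j with _ | j
      · simp
      · rw [Nat.choose_eq_zero_of_lt (by omega)]
        simp
    | 1 =>
      simp only [fibPoly, mul_one, add_zero, Polynomial.coeff_X]
      rcases j with _ | _ | j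
      · simp
      · simp
      · rw [Nat.choose_eq_zero_of_lt (by omega)]
        simp
    | n + 2 =>
      rw [fibPoly, Polynomial.coeff_add, ih n (by omega)]
      rcases j with _ | j
      · simp [Nat.even_add]
      · rw [Polynomial.coeff_X_mul, ih (n + 1) (by omega)]
        by_cases h : Even (n + (j + 1))
        · have h₁ : Even (n + 1 + j) := by convert h using 1; ring
          have h₂ : Even (n + 2 + (j + 1)) := by
            rw [show n + 2 + (j + 1) = n + (j + 1) + 2 by ring]; exact h.add even_two
          rw [if_pos h, if_pos h₁, if_pos h₂,
            show (n + 2 + (j + 1)) / 2 = (n + 1 + j) / 2 + 1 by omega,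
            show (n + (j + 1)) / 2 = (n + 1 + j) / 2 by omega, Nat.choose_succ_succ]
          push_cast
          ring
        · have h₁ : ¬ Even (n + 1 + j) := by convert h using 2; ring
          have h₂ : ¬ Even (n + 2 + (j + 1)) := by
            rw [Nat.even_iff] at h ⊢; omega
          rw [if_neg h, if_neg h₁, if_neg h₂, add_zero]

theorem Nat.succ_choose_add_two_mul (m i : ℕ) :
    (m + 1).choose (i + 2) * ((i + 1) * (i + 2)) = m.choose i * ((m + 1) * (m - i)) := by
  have h₁ := Nat.add_one_mul_choose_eq m (i + 1)
  have h₂ := Nat.choose_succ_right_eq m i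
  calc _ = (m + 1).choose (i + 1 + 1) * (i + 1 + 1) * (i + 1) := by ring_nf
    _ = (m + 1) * (m.choose (i + 1) * (i + 1)) := by rw [← h₁]; ring
    _ = _ := by rw [h₂]; ring

theorem Nat.choose_mul_choose_add_two_le (m i : ℕ) :
    m.choose i * (m + 2).choose (i + 4) ≤ (m + 1).choose (i + 2) ^ 2 := by
  rcases Nat.lt_or_ge m (i + 2) with h | h
  · rw [Nat.choose_eq_zero_of_lt (show m + 2 < i + 4 by omega)]
    simp
  · obtain ⟨k, rfl⟩ := Nat.exists_eq_add_of_le h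
    have h₁ := Nat.succ_choose_add_two_mul (i + 2 + k) i
    have h₂ := Nat.succ_choose_add_two_mul (i + 2 + k + 1) (i + 2)
    rw [show i + 2 + k - i = k + 2 by omega] at h₁
    rw [show i + 2 + k + 1 - (i + 2) = k + 1 by omega] at h₂
    simp only [add_assoc, Nat.reduceAdd] at h₁ h₂ ⊢
    generalize (i + (2 + k)).choose i = a at *
    generalize (i + (2 + (k + 1))).choose (i + 2) = d at *
    generalize (i + (2 + (k + 2))).choose (i + 4) = b at *
    refine Nat.le_of_mul_le_mul_right (c := ((i + (2 + (k + 1))) * (k + 2)) * ((i + 3) * (i + 4)))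
      ?_ (by positivity)
    calc _ = (a * ((i + (2 + (k + 1))) * (k + 2))) * (b * ((i + 3) * (i + 4))) := by ring
      _ = d ^ 2 * (((i + 1) * (i + (2 + (k + 2)))) * (k + 1) * (i + 2)) := by
        rw [← h₁, h₂]; ring
      _ ≤ d ^ 2 * (((i + 3) * (i + (2 + (k + 1)))) * (k + 2) * (i + 4)) := by
        have : (i + 1) * (i + (2 + (k + 2))) ≤ (i + 3) * (i + (2 + (k + 1))) := by nlinarith
        gcongr <;> omega
      _ = _ := by ring

/-- each Fibonacci polynomial is log-concave: since only powers of a single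
parity occur, this says `F_n.coeff (j-2) * F_n.coeff (j+2) ≤ F_n.coeff j ^ 2` for `j ≥ 2`. -/
theorem fibPoly_logConcave :
    ∀ n : ℕ, ∀ j : ℕ, 2 ≤ j →
      (fibPoly n).coeff (j - 2) * (fibPoly n).coeff (j + 2) ≤ (fibPoly n).coeff j ^ 2 := by
  intro n j hj
  obtain ⟨i, rfl⟩ := Nat.exists_eq_add_of_le' hj
  rcases n with _ | n
  · simp [fibPoly]
  · simp only [fibPoly_succ_coeff, Nat.add_sub_cancel]
    by_cases h : Even (n + i)
    · have h₁ : Even (n + (i + 2)) := by rw [← add_assoc]; exact h.add even_two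
      have h₂ : Even (n + (i + 2 + 2)) := by rw [← add_assoc n]; exact h₁.add even_two
      rw [if_pos h, if_pos h₁, if_pos h₂,
        show (n + (i + 2)) / 2 = (n + i) / 2 + 1 by omega,
        show (n + (i + 2 + 2)) / 2 = (n + i) / 2 + 2 by omega]
      exact_mod_cast Nat.choose_mul_choose_add_two_le ((n + i) / 2) i
    · rw [if_neg h, zero_mul]
      positivity
end
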